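/- Let n ≥ 2 and let D = (D₁,...,D_m) be an m-tuple of n×n real diagonal matrices (viewed as Hermitian matrices). Then for every linear map L : (H_n)^m → ℝ², the L-numerical range W_L(D) is star-shaped with star-center L((tr D₁/n)·I_n, ..., (tr D_m/n)·I_n). -/

import Mathlib

open Matrix

/-- The `L`-numerical range of an `m`-tuple of `n × n` complex matrices:
`W_L(A) = { L(U*A₁U, ..., U*A_mU) : U unitary }`. -/
noncomputable def LNumericalRange {n m l : ℕ}
    (L : (Fin m → Matrix (Fin n) (Fin n) ℂ) →ₗ[ℝ] (Fin l → ℝ))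
    (A : Fin m → Matrix (Fin n) (Fin n) ℂ) : Set (Fin l → ℝ) :=
  {y | ∃ U ∈ Matrix.unitaryGroup (Fin n) ℂ, y = L fun i => Uᴴ * A i * U}


theorem aux_pow_sub {R : Type*} [NormedRing R] (a b : R) (h1 : ‖(1:R)‖ ≤ 1) (ha : ‖a‖ ≤ 1)
    (hb : ‖b‖ ≤ 1) (N : ℕ) : ‖a ^ N - b ^ N‖ ≤ N * ‖a - b‖ := by
  induction N with
  | zero => simp
  | succ k ih =>
    have hbk : ‖b ^ k‖ ≤ 1 := by
      clear ih
      induction k with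
      | zero => simpa using h1
      | succ k ih =>
        rw [pow_succ]
        calc _ ≤ ‖b ^ k‖ * ‖b‖ := norm_mul_le _ _
          _ ≤ 1 * 1 := by gcongr
          _ = 1 := one_mul 1
    have : a ^ (k+1) - b ^ (k+1) = (a ^ k - b ^ k) * a + b ^ k * (a - b) := by
      rw [pow_succ, pow_succ]; noncomm_ring
    rw [this]
    calc _ ≤ ‖(a ^ k - b ^ k) * a‖ + ‖b ^ k * (a - b)‖ := norm_add_le _ _
      _ ≤ ‖a ^ k - b ^ k‖ * ‖a‖ + ‖b ^ k‖ * ‖a - b‖ := by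
          gcongr <;> exact norm_mul_le _ _
      _ ≤ (k * ‖a - b‖) * 1 + 1 * ‖a - b‖ := by gcongr
      _ = _ := by push_cast; ring

theorem aux_prod {R : Type*} [NormedRing R] [NormedAlgebra ℝ R] (h1 : ‖(1:R)‖ ≤ 1)
    (M : Submonoid R) (l : List R)
    (hl : ∀ E ∈ l, ∀ ε ∈ Set.Icc (0:ℝ) 1, ‖1 - ε • E‖ ≤ 1 ∧ 1 - ε • E ∈ M) :
    ∃ C : ℝ, 0 ≤ C ∧ ∀ ε ∈ Set.Icc (0:ℝ) 1, ∃ A ∈ M, ‖A‖ ≤ 1 ∧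
      ‖A - (1 - ε • l.sum)‖ ≤ C * ε ^ 2 := by
  induction l with
  | nil => exact ⟨0, le_rfl, fun ε _ => ⟨1, M.one_mem, h1, by simp⟩⟩
  | cons E l ih =>
    obtain ⟨C, hC, h⟩ := ih (fun F hF => hl F (List.mem_cons_of_mem _ hF))
    refine ⟨C + ‖E * l.sum‖, by positivity, fun ε hε => ?_⟩
    obtain ⟨A, hA, hA1, hA2⟩ := h ε hε
    obtain ⟨hE1, hE2⟩ := hl E (by simp) ε hε
    refine ⟨(1 - ε • E) * A, M.mul_mem hE2 hA, ?_, ?_⟩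
    · calc _ ≤ ‖1 - ε • E‖ * ‖A‖ := norm_mul_le _ _
        _ ≤ 1 * 1 := by gcongr
        _ = 1 := one_mul 1
    · have : (1 - ε • E) * A - (1 - ε • (E :: l).sum)
          = (1 - ε • E) * (A - (1 - ε • l.sum)) + (ε ^ 2) • (E * l.sum) := by
        rw [List.sum_cons]
        simp only [sub_mul, mul_sub, smul_mul_assoc, mul_smul_comm, one_mul, mul_one, smul_add,
          smul_sub, smul_smul, pow_two]
        abel
      rw [this]
      calc _ ≤ ‖(1 - ε • E) * (A - (1 - ε • l.sum))‖ + ‖(ε ^ 2) • (E * l.sum)‖ := norm_add_le _ _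
        _ ≤ ‖1 - ε • E‖ * ‖A - (1 - ε • l.sum)‖ + ε ^ 2 * ‖E * l.sum‖ := by
          gcongr
          · exact norm_mul_le _ _
          · rw [norm_smul]; simp
        _ ≤ 1 * (C * ε ^ 2) + ε ^ 2 * ‖E * l.sum‖ := by gcongr
        _ = _ := by ring

theorem aux_trotter {R : Type*} [NormedRing R] [NormedAlgebra ℝ R] (h1 : ‖(1:R)‖ ≤ 1)
    (M : Submonoid R) (hM : IsClosed (M : Set R)) (l : List R)
    (hl : ∀ E ∈ l, ∀ ε ∈ Set.Icc (0:ℝ) 1, ‖1 - ε • E‖ ≤ 1 ∧ 1 - ε • E ∈ M)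
    (P : R) (hP : P * P = P) (hP1 : ‖P‖ ≤ 1) (c : ℝ) (hc : 1 ≤ c) (hs : l.sum = c • (1 - P))
    (s : ℝ) (hs0 : 0 ≤ s) :
    Real.exp (-s) • 1 + (1 - Real.exp (-s)) • P ∈ M := by
  obtain ⟨C, hC, h⟩ := aux_prod h1 M l hl
  set B : ℝ → R := fun x => x • 1 + (1 - x) • P with hB
  have hBmul : ∀ x y, B x * B y = B (x * y) := by
    intro x y
    simp only [hB, add_mul, mul_add, smul_mul_assoc, mul_smul_comm, one_mul, mul_one, hP]
    module
  have hBpow : ∀ x (N : ℕ), B x ^ N = B (x ^ N) := by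
    intro x N
    induction N with
    | zero => simp [hB]
    | succ k ih => rw [pow_succ, ih, hBmul, pow_succ]
  have hBn : ∀ x ∈ Set.Icc (0:ℝ) 1, ‖B x‖ ≤ 1 := by
    rintro x ⟨hx0, hx1⟩
    calc _ ≤ ‖x • (1:R)‖ + ‖(1 - x) • P‖ := norm_add_le _ _
      _ = x * ‖(1:R)‖ + (1 - x) * ‖P‖ := by
        rw [norm_smul, norm_smul, Real.norm_of_nonneg hx0, Real.norm_of_nonneg (by linarith)]
      _ ≤ x * 1 + (1 - x) * 1 := by
        have : 0 ≤ 1 - x := by linarith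
        gcongr
      _ = 1 := by ring
  have key : ∀ N : ℕ, ∃ A ∈ M, ‖A - B (Real.exp (-s))‖ ≤ C * s ^ 2 / (N + 1 : ℕ) := by
    intro N
    set x := Real.exp (-s / (N+1 : ℕ)) with hx
    have hNpos : (0:ℝ) < (N+1 : ℕ) := by positivity
    have hx0 : 0 ≤ x := (Real.exp_pos _).le
    have hx1 : x ≤ 1 := Real.exp_le_one_iff.2 (by rw [neg_div]; simp; positivity)
    have hxs : 1 - x ≤ s / (N+1 : ℕ) := by
      have := Real.add_one_le_exp (-s / (N+1 : ℕ))
      rw [neg_div] at this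
      rw [hx, neg_div]; linarith
    have hxN : x ^ (N+1) = Real.exp (-s) := by
      rw [hx, ← Real.exp_nat_mul]; congr 1; field_simp
    have he0 : 0 ≤ (1 - x) / c := div_nonneg (by linarith) (by linarith)
    have he1 : (1 - x) / c ≤ 1 - x := div_le_self (by linarith) hc
    obtain ⟨A, hA, hA1, hA2⟩ := h ((1 - x) / c) ⟨he0, by linarith⟩
    have hBx : 1 - ((1 - x) / c) • l.sum = B x := by
      rw [hs, smul_smul, div_mul_cancel₀ _ (by positivity)]
      simp only [hB]; module
    rw [hBx] at hA2
    refine ⟨A ^ (N+1), M.pow_mem hA _, ?_⟩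
    rw [← hxN, ← hBpow]
    calc _ ≤ (N+1 : ℕ) * ‖A - B x‖ := aux_pow_sub _ _ h1 hA1 (hBn x ⟨hx0, hx1⟩) _
      _ ≤ (N+1 : ℕ) * (C * (s / (N+1 : ℕ)) ^ 2) := by
        gcongr
        refine hA2.trans ?_
        exact mul_le_mul_of_nonneg_left (pow_le_pow_left₀ he0 (he1.trans hxs) 2) hC
      _ = _ := by field_simp
  choose A hAM hA using key
  refine hM.mem_of_tendsto (b := Filter.atTop) (f := A) ?_ (Filter.Eventually.of_forall hAM)
  rw [tendsto_iff_norm_sub_tendsto_zero]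
  refine squeeze_zero (fun _ => norm_nonneg _) hA ?_
  exact (tendsto_const_div_atTop_nhds_zero_nat (C * s ^ 2)).comp (Filter.tendsto_add_atTop_nat 1)

theorem aux_sphere (x y z : ℝ) (h : x^2+y^2+z^2=1) : ∃ p q : ℂ,
    (starRingEnd ℂ p * p) = ((1+z)/2 : ℝ) ∧ starRingEnd ℂ q * q = ((1-z)/2 : ℝ) ∧
    2 * (starRingEnd ℂ p * q) = x + y * Complex.I := by
  by_cases hz : z = -1
  · subst hz
    have hx : x = 0 := by nlinarith
    have hy : y = 0 := by nlinarith
    exact ⟨0, 1, by norm_num, by norm_num, by simp [hx, hy]⟩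
  · have hz1 : 0 < 1 + z := by
      have : -1 ≤ z := by nlinarith
      have := lt_of_le_of_ne this (Ne.symm hz)
      linarith
    set r := Real.sqrt ((1+z)/2) with hr
    have hr2 : r * r = (1+z)/2 := Real.mul_self_sqrt (by linarith)
    have hr0 : r ≠ 0 := by
      intro h0; rw [h0] at hr2; linarith
    refine ⟨r, (x + y * Complex.I) / (2 * r), ?_, ?_, ?_⟩
    · rw [Complex.conj_ofReal, ← hr2]; push_cast; rfl
    · have hc : (r:ℂ) ≠ 0 := by exact_mod_cast hr0
      simp only [map_div₀, map_add, map_mul, Complex.conj_ofReal, Complex.conj_I, map_ofNat]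
      rw [div_mul_div_comm, div_eq_iff (by simp [hc])]
      have e1 : ((x:ℂ) + y * -Complex.I) * (x + y * Complex.I) = ((x^2+y^2 : ℝ) : ℂ) := by
        push_cast; ring_nf; simp
      rw [e1]
      have e2 : (2:ℂ) * r * (2 * r) = ((4 * (r * r) : ℝ) : ℂ) := by push_cast; ring
      rw [e2, hr2, ← Complex.ofReal_mul]
      congr 1
      nlinarith
    · have hc : (r:ℂ) ≠ 0 := by exact_mod_cast hr0
      rw [Complex.conj_ofReal]; field_simp

/-- Pauli-like matrix supported on the `i,j` block. -/
noncomputable def auxK {n : ℕ} (i j : Fin n) (x y z : ℝ) : Matrix (Fin n) (Fin n) ℂ :=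
  Matrix.of fun a b => if a = i then (if b = i then (z:ℂ) else if b = j then x + y * Complex.I else 0)
    else if a = j then (if b = i then x - y * Complex.I else if b = j then -(z:ℂ) else 0) else 0

theorem aux_conj {n : ℕ} (i j : Fin n) (hij : i ≠ j) (x y z : ℝ) (h : x^2+y^2+z^2=1) :
    ∃ G : Matrix (Fin n) (Fin n) ℂ, ∀ δ : Fin n → ℝ,
      Gᴴ * Matrix.diagonal (fun k => (δ k : ℂ)) * G =
        Matrix.diagonal (fun k => (((δ k + δ (Equiv.swap i j k)) / 2 : ℝ) : ℂ)) +
        ((δ i - δ j) / 2 : ℝ) • auxK i j x y z := by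
  obtain ⟨p, q, hp, hq, hpq⟩ := aux_sphere x y z h
  have hpq' : 2 * (p * starRingEnd ℂ q) = x - y * Complex.I := by
    have := congrArg (starRingEnd ℂ) hpq
    simp only [map_mul, map_add, Complex.conj_conj, Complex.conj_ofReal, Complex.conj_I, map_ofNat] at this
    rw [this]; ring
  refine ⟨Matrix.of fun a b => if a = i then (if b = i then p else if b = j then q else 0)
    else if a = j then (if b = i then - starRingEnd ℂ q else if b = j then starRingEnd ℂ p else 0)
    else if a = b then 1 else 0, fun δ => ?_⟩
  ext a b
  rw [Matrix.mul_apply]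
  simp only [Matrix.mul_diagonal, Matrix.conjTranspose_apply, Matrix.of_apply, Matrix.add_apply,
    Matrix.smul_apply, auxK, Matrix.diagonal_apply]
  rw [← Finset.add_sum_erase _ _ (Finset.mem_univ i),
    ← Finset.add_sum_erase _ _ (show j ∈ Finset.univ.erase i by simp [hij.symm])]
  have hrest : ∀ k ∈ (Finset.univ.erase i).erase j, k ≠ i ∧ k ≠ j := by
    intro k hk; simp at hk; tauto
  rw [Finset.sum_congr rfl (g := fun k => if k = a then (if a = b then (δ a : ℂ) else 0) else 0)
    (by
      intro k hk
      obtain ⟨h1, h2⟩ := hrest k hk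
      simp only [h1, h2, if_false]
      split_ifs <;> simp_all)]
  rw [Finset.sum_ite_eq']
  simp only [Finset.mem_erase, Finset.mem_univ, and_true, if_true, hij, hij.symm, if_false]
  by_cases hai : a = i
  · subst hai
    by_cases hbi : b = a
    · subst hbi
      simp [hij]
      push_cast at hp hq
      linear_combination (δ b : ℂ) * hp + (δ j : ℂ) * hq
    · by_cases hbj : b = j
      · subst hbj
        simp [hij, hij.symm]
        linear_combination ((δ a : ℂ) - δ b) / 2 * hpq
      · simp [hij, hbi, hbj, Ne.symm hbi]
  · by_cases haj : a = j
    · subst haj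
      by_cases hbi : b = i
      · subst hbi
        simp [hij, hij.symm]
        linear_combination ((δ b : ℂ) - δ a) / 2 * hpq'
      · by_cases hbj : b = a
        · subst hbj
          simp [hij.symm]
          push_cast at hp hq
          linear_combination (δ i : ℂ) * hq + (δ b : ℂ) * hp
        · simp [hij.symm, hbi, hbj, Ne.symm hbj]
    · by_cases hab : a = b
      · subst hab
        simp [hai, haj, Equiv.swap_apply_of_ne_of_ne hai haj]
      · simp [hai, haj, hab]

theorem aux_compact (n : ℕ) : IsCompact ((Matrix.unitaryGroup (Fin n) ℂ : Set (Matrix (Fin n) (Fin n) ℂ))) := by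
  have hc : IsClosed ((Matrix.unitaryGroup (Fin n) ℂ : Set (Matrix (Fin n) (Fin n) ℂ))) := by
    have : ((Matrix.unitaryGroup (Fin n) ℂ : Set (Matrix (Fin n) (Fin n) ℂ))) =
        {A | A * star A = 1} := by
      ext A; exact Matrix.mem_unitaryGroup_iff
    rw [this]
    refine isClosed_eq ?_ continuous_const
    exact continuous_id.matrix_mul continuous_id.matrix_conjTranspose
  have hK : IsCompact (Set.univ.pi fun _ : Fin n => Set.univ.pi fun _ : Fin n =>
      Metric.closedBall (0:ℂ) 1) :=
    isCompact_univ_pi fun _ => isCompact_univ_pi fun _ => isCompact_closedBall _ _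
  refine hK.of_isClosed_subset hc ?_
  intro U hU i _ j _
  simpa using entry_norm_bound_of_unitary hU i j

theorem aux_closed {n m : ℕ} (L : (Fin m → Matrix (Fin n) (Fin n) ℂ) →ₗ[ℝ] (Fin 2 → ℝ))
    (A : Fin m → Matrix (Fin n) (Fin n) ℂ) : IsClosed (LNumericalRange L A) := by
  have : LNumericalRange L A = (fun U => L fun i => Uᴴ * A i * U) ''
      (Matrix.unitaryGroup (Fin n) ℂ : Set (Matrix (Fin n) (Fin n) ℂ)) := by
    ext y
    simp only [LNumericalRange, Set.mem_setOf_eq, Set.mem_image, SetLike.mem_coe, eq_comm]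
  rw [this]
  refine ((aux_compact n).image ?_).isClosed
  have hL : Continuous L := L.continuous_of_finiteDimensional
  refine hL.comp (continuous_pi fun i => ?_)
  exact (continuous_id.matrix_conjTranspose.matrix_mul continuous_const).matrix_mul continuous_id

theorem aux_kernel (T : (Fin 3 → ℝ) →ₗ[ℝ] (Fin 2 → ℝ)) (z : ℝ) (hz : z ^ 2 ≤ 1) :
    ∃ v : Fin 3 → ℝ, v 0 ^ 2 + v 1 ^ 2 + v 2 ^ 2 = 1 ∧ T v = T ![0, 0, z] := by
  have hk : LinearMap.ker T ≠ ⊥ := LinearMap.ker_ne_bot_of_finrank_lt (by simp)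
  obtain ⟨w, hw, hw0⟩ := (Submodule.ne_bot_iff _).1 hk
  have ha : 0 < w 0 ^ 2 + w 1 ^ 2 + w 2 ^ 2 := by
    by_contra hcon
    apply hw0
    have h0 : w 0 = 0 := by nlinarith [sq_nonneg (w 0), sq_nonneg (w 1), sq_nonneg (w 2)]
    have h1 : w 1 = 0 := by nlinarith [sq_nonneg (w 0), sq_nonneg (w 1), sq_nonneg (w 2)]
    have h2 : w 2 = 0 := by nlinarith [sq_nonneg (w 0), sq_nonneg (w 1), sq_nonneg (w 2)]
    ext k; fin_cases k <;> simp [h0, h1, h2]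
  set a := w 0 ^ 2 + w 1 ^ 2 + w 2 ^ 2
  obtain ⟨t, ht⟩ := exists_quadratic_eq_zero (a := a) (b := 2 * z * w 2) (c := z ^ 2 - 1) ha.ne'
    ⟨Real.sqrt (discrim a (2 * z * w 2) (z ^ 2 - 1)), by
      rw [Real.mul_self_sqrt]
      unfold discrim
      nlinarith [sq_nonneg (2 * z * w 2), mul_nonneg ha.le (sub_nonneg.2 hz)]⟩
  refine ⟨![0, 0, z] + t • w, ?_, ?_⟩
  · simp only [Pi.add_apply, Pi.smul_apply, smul_eq_mul]
    simp
    simp only [a] at ht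
    linear_combination ht
  · rw [map_add, map_smul, LinearMap.mem_ker.1 hw]; simp

/-- linear version of `auxK`. -/
noncomputable def auxKL {n : ℕ} (i j : Fin n) : (Fin 3 → ℝ) →ₗ[ℝ] Matrix (Fin n) (Fin n) ℂ where
  toFun v := auxK i j (v 0) (v 1) (v 2)
  map_add' u v := by
    ext a b
    simp only [auxK, Matrix.add_apply, Matrix.of_apply, Pi.add_apply]
    split_ifs <;> push_cast <;> ring
  map_smul' c v := by
    ext a b
    simp only [auxK, Matrix.smul_apply, Matrix.of_apply, Pi.smul_apply, RingHom.id_apply]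
    split_ifs <;> simp <;> ring

/-- diagonal tuples whose whole unitary orbit is mapped into `W`. -/
def auxS {n m : ℕ} (L : (Fin m → Matrix (Fin n) (Fin n) ℂ) →ₗ[ℝ] (Fin 2 → ℝ))
    (W : Set (Fin 2 → ℝ)) : Set (Fin m → Fin n → ℝ) :=
  {δ | ∀ U ∈ Matrix.unitaryGroup (Fin n) ℂ,
    (L fun k => Uᴴ * Matrix.diagonal (fun a => (δ k a : ℂ)) * U) ∈ W}

theorem aux_step {n m : ℕ} (L : (Fin m → Matrix (Fin n) (Fin n) ℂ) →ₗ[ℝ] (Fin 2 → ℝ))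
    (W : Set (Fin 2 → ℝ)) (i j : Fin n) (hij : i ≠ j) (ε : ℝ) (hε : ε ∈ Set.Icc (0:ℝ) 1)
    (δ : Fin m → Fin n → ℝ) (hδ : δ ∈ auxS L W) :
    (fun k a => (1 - ε) * δ k a + ε * δ k (Equiv.swap i j a)) ∈ auxS L W := by
  intro U hU
  let T : (Fin 3 → ℝ) →ₗ[ℝ] (Fin 2 → ℝ) := L ∘ₗ LinearMap.pi fun k =>
    (((δ k i - δ k j) / 2 : ℝ) • (LinearMap.mulRight ℝ U ∘ₗ LinearMap.mulLeft ℝ Uᴴ ∘ₗ auxKL i j))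
  have hT : ∀ v, T v = L fun k => Uᴴ * (((δ k i - δ k j) / 2 : ℝ) • auxK i j (v 0) (v 1) (v 2)) * U := by
    intro v
    simp only [T, LinearMap.comp_apply]
    congr 1
    ext1 k
    simp [auxKL]
  let c : Fin 2 → ℝ := L fun k =>
    Uᴴ * Matrix.diagonal (fun a => (((δ k a + δ k (Equiv.swap i j a)) / 2 : ℝ) : ℂ)) * U
  obtain ⟨v, hv, hTv⟩ := aux_kernel T (1 - 2 * ε) (by nlinarith [hε.1, hε.2])
  obtain ⟨G, hG⟩ := aux_conj i j hij _ _ _ hv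
  have hGU : G ∈ Matrix.unitaryGroup (Fin n) ℂ := by
    rw [Matrix.mem_unitaryGroup_iff']
    have := hG 1
    simpa [Matrix.star_eq_conjTranspose] using this
  have h1 := hδ (G * U) (mul_mem hGU hU)
  have h2 : (L fun k => (G * U)ᴴ * Matrix.diagonal (fun a => (δ k a : ℂ)) * (G * U)) = c + T v := by
    rw [hT, ← map_add]
    congr 1
    ext1 k
    rw [Pi.add_apply, ← add_mul, ← mul_add, ← hG (δ k), Matrix.conjTranspose_mul]
    simp only [Matrix.mul_assoc]
  rw [h2, hTv, hT, ← map_add] at h1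
  convert h1 using 2
  ext1 k
  rw [Pi.add_apply, ← add_mul, ← mul_add]
  congr 2
  ext a b
  simp only [Matrix.diagonal_apply, Matrix.add_apply, Matrix.smul_apply, auxK, Matrix.of_apply]
  simp
  by_cases hai : a = i
  · subst hai
    by_cases hab : a = b
    · subst hab
      simp
      ring
    · simp [hab, Ne.symm hab]
  · by_cases haj : a = j
    · subst haj
      by_cases hab : a = b
      · subst hab
        simp [hai]
        ring
      · simp [hab, hai, Ne.symm hab]
    · by_cases hab : a = b
      · subst hab
        simp [hai, haj, Equiv.swap_apply_of_ne_of_ne hai haj]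
        ring
      · simp [hab, hai, haj]

/-- the monoid of operators preserving `auxS`. -/
noncomputable def auxM {n m : ℕ} (L : (Fin m → Matrix (Fin n) (Fin n) ℂ) →ₗ[ℝ] (Fin 2 → ℝ))
    (W : Set (Fin 2 → ℝ)) : Submonoid ((Fin n → ℝ) →L[ℝ] (Fin n → ℝ)) where
  carrier := {T | ∀ δ ∈ auxS L W, (fun k => T (δ k)) ∈ auxS L W}
  mul_mem' {a b} ha hb δ hδ := ha _ (hb δ hδ)
  one_mem' δ hδ := hδ

theorem auxM_closed {n m : ℕ} (L : (Fin m → Matrix (Fin n) (Fin n) ℂ) →ₗ[ℝ] (Fin 2 → ℝ))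
    (W : Set (Fin 2 → ℝ)) (hW : IsClosed W) :
    IsClosed (auxM (n := n) (m := m) L W : Set ((Fin n → ℝ) →L[ℝ] (Fin n → ℝ))) := by
  have : (auxM (n := n) (m := m) L W : Set ((Fin n → ℝ) →L[ℝ] (Fin n → ℝ))) =
      ⋂ δ ∈ auxS L W, ⋂ U ∈ Matrix.unitaryGroup (Fin n) ℂ,
      (fun T : (Fin n → ℝ) →L[ℝ] (Fin n → ℝ) =>
        L fun k => Uᴴ * Matrix.diagonal (fun a => (T (δ k) a : ℂ)) * U) ⁻¹' W := by
    ext T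
    simp only [Set.mem_iInter, Set.mem_preimage]
    rfl
  rw [this]
  refine isClosed_biInter fun δ _ => isClosed_biInter fun U _ => hW.preimage ?_
  have hL : Continuous L := L.continuous_of_finiteDimensional
  refine hL.comp (continuous_pi fun i => ?_)
  refine (continuous_const.matrix_mul (Continuous.matrix_diagonal ?_)).matrix_mul continuous_const
  refine continuous_pi fun a => Complex.continuous_ofReal.comp ?_
  exact (continuous_apply a).comp (ContinuousLinearMap.apply ℝ (Fin n → ℝ) (δ i)).continuous

/-- swap operator -/
noncomputable def auxSw {n : ℕ} (i j : Fin n) : (Fin n → ℝ) →L[ℝ] (Fin n → ℝ) :=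
  ContinuousLinearMap.pi fun a => ContinuousLinearMap.proj (Equiv.swap i j a)

theorem auxSw_apply {n : ℕ} (i j : Fin n) (x : Fin n → ℝ) (a : Fin n) :
    auxSw i j x a = x (Equiv.swap i j a) := rfl

/-- mean operator -/
noncomputable def auxP (n : ℕ) : (Fin n → ℝ) →L[ℝ] (Fin n → ℝ) :=
  ContinuousLinearMap.pi fun _ => (n : ℝ)⁻¹ • ∑ b, ContinuousLinearMap.proj b

theorem auxP_apply {n : ℕ} (x : Fin n → ℝ) (a : Fin n) :
    auxP n x a = (n : ℝ)⁻¹ * ∑ b, x b := by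
  simp [auxP]

theorem aux_B_mem {n m : ℕ} (hn : 2 ≤ n)
    (L : (Fin m → Matrix (Fin n) (Fin n) ℂ) →ₗ[ℝ] (Fin 2 → ℝ))
    (W : Set (Fin 2 → ℝ)) (hW : IsClosed W) (α : ℝ) (hα : α ∈ Set.Icc (0:ℝ) 1) :
    α • 1 + (1 - α) • auxP n ∈ auxM (n := n) (m := m) L W := by
  have hn0 : (0:ℝ) < n := by positivity
  have hM := auxM_closed (n := n) (m := m) L W hW
  have h1 : ‖(1 : (Fin n → ℝ) →L[ℝ] (Fin n → ℝ))‖ ≤ 1 := ContinuousLinearMap.norm_id_le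
  have hpos : ∀ α : ℝ, 0 < α → α ≤ 1 →
      α • 1 + (1 - α) • auxP n ∈ auxM (n := n) (m := m) L W := by
    intro α h0 hle
    have := aux_trotter h1 (auxM (n := n) (m := m) L W) hM
      ((Finset.univ : Finset (Fin n × Fin n)).toList.map fun p => 1 - auxSw p.1 p.2)
      ?_ (auxP n) ?_ ?_ (2 * n) ?_ ?_ (- Real.log α) (by
        have := Real.log_nonpos h0.le hle; linarith)
    · rwa [neg_neg, Real.exp_log h0] at this
    · intro E hE ε hε
      simp only [List.mem_map, Finset.mem_toList, Finset.mem_univ, true_and] at hE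
      obtain ⟨⟨i, j⟩, rfl⟩ := hE
      have hap : ∀ x a, (1 - ε • (1 - auxSw i j) : (Fin n → ℝ) →L[ℝ] (Fin n → ℝ)) x a
          = (1 - ε) * x a + ε * x (Equiv.swap i j a) := by
        intro x a
        simp [auxSw_apply]; ring
      have hε' : 0 ≤ 1 - ε := by linarith [hε.2]
      constructor
      · refine ContinuousLinearMap.opNorm_le_bound _ zero_le_one fun x => ?_
        rw [one_mul]
        refine (pi_norm_le_iff_of_nonneg (norm_nonneg _)).2 fun a => ?_
        rw [hap]
        calc _ ≤ ‖(1 - ε) * x a‖ + ‖ε * x (Equiv.swap i j a)‖ := norm_add_le _ _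
          _ = (1 - ε) * ‖x a‖ + ε * ‖x (Equiv.swap i j a)‖ := by
            rw [norm_mul, norm_mul, Real.norm_of_nonneg hε', Real.norm_of_nonneg hε.1]
          _ ≤ (1 - ε) * ‖x‖ + ε * ‖x‖ := by
            have := hε.1
            gcongr <;> exact norm_le_pi_norm _ _
          _ = _ := by ring
      · intro δ hδ
        by_cases hij : i = j
        · subst hij
          convert hδ using 1
          ext k a
          rw [hap]; simp; ring
        · convert aux_step L W i j hij ε hε δ hδ using 1
          ext k a
          rw [hap]
    · ext x a
      rw [ContinuousLinearMap.mul_apply, auxP_apply]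
      simp only [auxP_apply, Finset.sum_const, Finset.card_univ, Fintype.card_fin, nsmul_eq_mul]
      field_simp
    · refine ContinuousLinearMap.opNorm_le_bound _ zero_le_one fun x => ?_
      rw [one_mul]
      refine (pi_norm_le_iff_of_nonneg (norm_nonneg _)).2 fun a => ?_
      rw [auxP_apply, norm_mul, norm_inv, Real.norm_of_nonneg hn0.le, inv_mul_le_iff₀ hn0]
      calc _ ≤ ∑ b, ‖x b‖ := norm_sum_le _ _
        _ ≤ ∑ _b : Fin n, ‖x‖ := Finset.sum_le_sum fun b _ => norm_le_pi_norm _ _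
        _ = _ := by simp
    · have : (2:ℝ) ≤ n := by exact_mod_cast hn
      linarith
    · rw [Finset.sum_map_toList]
      ext x a
      rw [ContinuousLinearMap.sum_apply, Finset.sum_apply, Fintype.sum_prod_type]
      simp only [ContinuousLinearMap.sub_apply, ContinuousLinearMap.smul_apply, Pi.sub_apply,
        Pi.smul_apply, auxP_apply, auxSw_apply, ContinuousLinearMap.one_apply, smul_eq_mul]
      have hrow : ∀ i, ∑ j, (x a - x (Equiv.swap i j a)) =
          (x a - x i) + (if i = a then ∑ j, (x a - x j) else 0) := by
        intro i
        by_cases hi : i = a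
        · subst hi
          simp
        · rw [Finset.sum_eq_single a]
          · simp [hi]
          · intro b _ hb
            rw [Equiv.swap_apply_of_ne_of_ne (Ne.symm hi) (Ne.symm hb), sub_self]
          · simp
      simp only [hrow]
      rw [Finset.sum_add_distrib, Finset.sum_ite_eq']
      simp only [Finset.mem_univ, if_true, Finset.sum_sub_distrib, Finset.sum_const,
        Finset.card_univ, Fintype.card_fin, nsmul_eq_mul]
      field_simp
      ring
  have hcl : IsClosed {α : ℝ | α • 1 + (1 - α) • auxP n ∈ auxM (n := n) (m := m) L W} :=
    hM.preimage (f := fun α : ℝ => α • (1 : (Fin n → ℝ) →L[ℝ] (Fin n → ℝ)) + (1 - α) • auxP n)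
      (by fun_prop)
  have hsub : Set.Ioc (0:ℝ) 1 ⊆ {α : ℝ | α • 1 + (1 - α) • auxP n ∈ auxM (n := n) (m := m) L W} :=
    fun α h => hpos α h.1 h.2
  have := closure_minimal hsub hcl
  rw [closure_Ioc (by norm_num)] at this
  exact this hα

/-- For `n ≥ 2`, a tuple of real diagonal matrices `D` and a linear map `L : H_n^m → ℝ²`,
`W_L(D)` is star-shaped with star-center `L((tr D₁/n)·Iₙ, ..., (tr D_m/n)·Iₙ)`. -/
theorem stmt11 {n m : ℕ} (hn : 2 ≤ n) (d : Fin m → Fin n → ℝ)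
    (L : (Fin m → Matrix (Fin n) (Fin n) ℂ) →ₗ[ℝ] (Fin 2 → ℝ)) :
    (L fun i => (Matrix.trace (Matrix.diagonal fun j => (d i j : ℂ)) / n) •
        (1 : Matrix (Fin n) (Fin n) ℂ)) ∈
      LNumericalRange L (fun i => Matrix.diagonal fun j => (d i j : ℂ)) ∧
    ∀ x ∈ LNumericalRange L (fun i => Matrix.diagonal fun j => (d i j : ℂ)),
      ∀ α ∈ Set.Icc (0 : ℝ) 1,
        α • x + (1 - α) • (L fun i =>
            (Matrix.trace (Matrix.diagonal fun j => (d i j : ℂ)) / n) •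
              (1 : Matrix (Fin n) (Fin n) ℂ)) ∈
          LNumericalRange L (fun i => Matrix.diagonal fun j => (d i j : ℂ)) := by
  have main : ∀ x ∈ LNumericalRange L (fun i => Matrix.diagonal fun j => (d i j : ℂ)),
      ∀ α ∈ Set.Icc (0 : ℝ) 1,
        α • x + (1 - α) • (L fun i =>
            (Matrix.trace (Matrix.diagonal fun j => (d i j : ℂ)) / n) •
              (1 : Matrix (Fin n) (Fin n) ℂ)) ∈
          LNumericalRange L (fun i => Matrix.diagonal fun j => (d i j : ℂ)) := by
    rintro x ⟨U, hU, rfl⟩ α hα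
    have hd : d ∈ auxS L (LNumericalRange L (fun i => Matrix.diagonal fun j => (d i j : ℂ))) :=
      fun V hV => ⟨V, hV, rfl⟩
    have h := aux_B_mem hn L _ (aux_closed L (fun i => Matrix.diagonal fun j => (d i j : ℂ))) α hα
      d hd U hU
    convert h using 1
    rw [← map_smul, ← map_smul, ← map_add]
    congr 1
    ext1 k
    rw [Pi.add_apply, Pi.smul_apply, Pi.smul_apply]
    have hUU : Uᴴ * U = 1 := Matrix.mem_unitaryGroup_iff'.1 hU
    have hdiag : Matrix.diagonal (fun a => (((α • (1 : (Fin n → ℝ) →L[ℝ] (Fin n → ℝ)) +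
        (1 - α) • auxP n) (d k) a : ℝ) : ℂ)) =
        α • Matrix.diagonal (fun a => (d k a : ℂ)) + (1 - α) •
        ((Matrix.trace (Matrix.diagonal fun j => (d k j : ℂ)) / n) •
              (1 : Matrix (Fin n) (Fin n) ℂ)) := by
      ext a b
      by_cases hab : a = b
      · subst hab
        simp [auxP_apply, Matrix.trace]
        left
        ring
      · simp [hab]
    rw [hdiag, mul_add, add_mul, mul_smul_comm, smul_mul_assoc, mul_smul_comm, smul_mul_assoc,
      mul_smul_comm, smul_mul_assoc, mul_one, hUU]
  refine ⟨?_, main⟩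
  have h := main _ ⟨1, one_mem _, rfl⟩ 0 (by simp)
  simpa using h
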